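/- arXiv:2007.07865 — 2 statements merged into one kernel-verified Lean document; each statement's English description precedes it below -/
import Mathlib

section
/- (Diameter estimate for extended blocks.) Let 1 ≤ s ≤ d−1 and assume δ_{s−1} + dε < 1. Then there exists a positive constant F, depending only on 𝔠, 𝔉, d, ε, τ, δ_{s−1}, C_{s−1} and D_{s−1}, such that for every submodule M of ℤ^d of dimension s and every ζ ∈ E⁽ˢ⁾_M there exists ξ ∈ B⁽ˢ⁾_M with ζ − ξ ∈ M, ‖ξ − ζ‖ ≤ F ⟨ξ+κ⟩^{δ_{s−1} + εd} and ‖ξ − ζ‖ ≤ F ⟨ζ+κ⟩^{δ_{s−1} + εd}. -/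
/-- A positive definite symmetric bilinear form on `ℝ^d`. -/
structure PDForm (d : ℕ) where
  B : (Fin d → ℝ) →ₗ[ℝ] (Fin d → ℝ) →ₗ[ℝ] ℝ
  symm : ∀ x y, B x y = B y x
  posdef : ∀ x, x ≠ 0 → 0 < B x x

namespace PDForm

variable {d : ℕ} (g : PDForm d)

/-- The inner product `⟨·,·⟩` associated with the form. -/
def inn (x y : Fin d → ℝ) : ℝ := g.B x y

/-- The norm `‖·‖` associated with the form. -/
noncomputable def nrm (x : Fin d → ℝ) : ℝ := Real.sqrt (g.inn x x)

/-- The Japanese bracket `⟨x⟩ = (1+‖x‖²)^{1/2}`. -/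
noncomputable def jap (x : Fin d → ℝ) : ℝ := Real.sqrt (1 + g.inn x x)

end PDForm

/-- Cast of a lattice vector of `ℤ^d` into `ℝ^d`. -/
def zc {d : ℕ} (k : Fin d → ℤ) : Fin d → ℝ := fun i => (k i : ℝ)

/-- `𝔠 := min{‖k‖² : k ∈ ℤ^d, k ≠ 0}`. -/
noncomputable def frakc {d : ℕ} (g : PDForm d) : ℝ :=
  sInf {x | ∃ k : Fin d → ℤ, k ≠ 0 ∧ x = (g.nrm (zc k)) ^ 2}

/-- Gram volume `√det(⟨u_i,u_j⟩)` of an `s`-tuple of vectors. -/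
noncomputable def gvol {d s : ℕ} (g : PDForm d) (u : Fin s → (Fin d → ℝ)) : ℝ :=
  Real.sqrt (Matrix.det (Matrix.of fun i j => g.inn (u i) (u j)))

/-- `𝔉`, the minimal Gram volume of parallelepipeds with linearly independent integer edges. -/
noncomputable def frakC {d : ℕ} (g : PDForm d) : ℝ :=
  sInf {x | ∃ (s : ℕ) (u : Fin s → (Fin d → ℤ)), 1 ≤ s ∧ s ≤ d ∧
    LinearIndependent ℝ (fun j => zc (u j)) ∧ x = gvol g (fun j => zc (u j))}

/-- A submodule of `ℤ^d` in the sense of the paper: `span_ℝ(M) ∩ ℤ^d = M`. -/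
def IsSat {d : ℕ} (M : Submodule ℤ (Fin d → ℤ)) : Prop :=
  ∀ k : Fin d → ℤ, zc k ∈ Submodule.span ℝ (zc '' (M : Set (Fin d → ℤ))) → k ∈ M

/-- The dimension (rank) of a submodule of `ℤ^d`. -/
noncomputable def zrank {d : ℕ} (M : Submodule ℤ (Fin d → ℤ)) : ℕ := Module.finrank ℤ M

/-- `ξ_k := ξ + κ + k/2`. -/
noncomputable def xik {d : ℕ} (κ : Fin d → ℝ) (ξ k : Fin d → ℤ) : Fin d → ℝ :=
  fun i => (ξ i : ℝ) + κ i + (k i : ℝ) / 2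

/-- All the data entering the definition of the resonant zones. -/
structure ZoneData (d : ℕ) where
  g : PDForm d
  κ : Fin d → ℝ
  E : Set (Fin d → ℤ)
  δ : ℝ
  ε : ℝ
  τ : ℝ
  Cs : ℕ → ℝ
  Ds : ℕ → ℝ

namespace ZoneData

variable {d : ℕ} (Z : ZoneData d)

/-- `δ_s := δ + s (d+τ+1) ε`. -/
noncomputable def δs (s : ℕ) : ℝ := Z.δ + s * ((d + Z.τ + 1) * Z.ε)

/-- The completely nonresonant zone `Z⁽⁰⁾`. -/
noncomputable def Z0 : Set (Fin d → ℤ) :=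
  {ξ | ξ ∈ Z.E ∧ ∀ k : Fin d → ℤ, k ≠ 0 →
    Z.g.nrm (zc k) ≤ (Z.g.jap (xik Z.κ ξ k)) ^ Z.ε →
    |Z.g.inn (xik Z.κ ξ k) (zc k)| >
      (Z.g.jap (xik Z.κ ξ k)) ^ Z.δ * (Z.g.nrm (zc k)) ^ (-Z.τ)}

/-- The resonant zone `Z⁽ˢ⁾_M`, union over linearly independent `s`-tuples in `M`
of the zones `Z_{k₁,…,k_s}`. -/
noncomputable def ZM (s : ℕ) (M : Submodule ℤ (Fin d → ℤ)) : Set (Fin d → ℤ) :=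
  {ξ | ξ ∈ Z.E ∧ ∃ (hs : 0 < s) (k : Fin s → (Fin d → ℤ)),
    (∀ j, k j ∈ M) ∧ LinearIndependent ℝ (fun j => zc (k j)) ∧
    ∀ j : Fin s,
      |Z.g.inn (xik Z.κ ξ (k ⟨0, hs⟩)) (zc (k j))| ≤
        Z.Cs j * (Z.g.jap (xik Z.κ ξ (k ⟨0, hs⟩))) ^ (Z.δs j) * (Z.g.nrm (zc (k j))) ^ (-Z.τ) ∧
      Z.g.nrm (zc (k j)) ≤ Z.Ds j * (Z.g.jap (xik Z.κ ξ (k ⟨0, hs⟩))) ^ Z.ε}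

/-- The resonant block `B⁽ˢ⁾_M`. -/
noncomputable def BM (s : ℕ) (M : Submodule ℤ (Fin d → ℤ)) : Set (Fin d → ℤ) :=
  Z.ZM s M \
    ⋃ (M' : Submodule ℤ (Fin d → ℤ)) (_ : IsSat M' ∧ zrank M' = s + 1), Z.ZM (s + 1) M'

/-- The extended block `E⁽ˢ⁾_M` (for `s ≥ 1`). -/
noncomputable def EM : ℕ → Submodule ℤ (Fin d → ℤ) → Set (Fin d → ℤ)
  | s, M =>
    {ξ | (∃ b ∈ Z.BM s M, ∃ m ∈ M, ξ = b + m) ∧ ξ ∈ Z.ZM s M ∧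
      ∀ r, 1 ≤ r → r < s → ∀ M' : Submodule ℤ (Fin d → ℤ),
        IsSat M' → zrank M' = r → ξ ∉ EM r M'}
  termination_by s => s

end ZoneData

/-- Conditions on the parameters `δ, ε, τ`. -/
def ParamsOK (d : ℕ) (δ ε τ : ℝ) : Prop :=
  1 ≤ d ∧ 0 < δ ∧ δ < 1 ∧ 0 < ε ∧ (d : ℝ) - 1 < τ ∧
    δ + d * ((d + τ + 1) * ε) < 1 ∧ ε * (τ + 1) ≤ δ

/-- Conditions `1 = C₀ < C₁ < ⋯ < C_{d-1}` and `1 = D₀ < D₁ < ⋯ < D_{d-1}`. -/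
def SeqOK (d : ℕ) (Cs Ds : ℕ → ℝ) : Prop :=
  Cs 0 = 1 ∧ Ds 0 = 1 ∧ (∀ j, j + 2 ≤ d → Cs j < Cs (j + 1)) ∧
    (∀ j, j + 2 ≤ d → Ds j < Ds (j + 1))



open Module in
theorem OrthonormalBasis.abs_det_le_prod_norm {W : Type*} [NormedAddCommGroup W]
    [InnerProductSpace ℝ W] {n : ℕ} (b : OrthonormalBasis (Fin n) ℝ W) (v : Fin n → W) :
    |b.toBasis.det v| ≤ ∏ i, ‖v i‖ := by
  have : Fact (finrank ℝ W = n) := ⟨by simpa using finrank_eq_card_basis b.toBasis⟩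
  rw [← b.toBasis.orientation.volumeForm_robust' b]
  exact b.toBasis.orientation.abs_volumeForm_apply_le v

theorem OrthonormalBasis.det_gram_eq_sq {W : Type*} [NormedAddCommGroup W]
    [InnerProductSpace ℝ W] {n : ℕ} (b : OrthonormalBasis (Fin n) ℝ W) (v : Fin n → W) :
    (Matrix.gram ℝ v).det = (b.toBasis.det v) ^ 2 := by
  have h : Matrix.of (fun i j => b.repr (v j) i) = b.toBasis.toMatrix v := by
    ext i j
    simp [Module.Basis.toMatrix_apply]
  rw [Matrix.gram_eq_conjTranspose_mul b v, h, Matrix.det_mul, Matrix.det_conjTranspose,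
    Module.Basis.det_apply, star_trivial, sq]

/-- A linearly independent family lies in a subspace having an orthonormal basis with the same
index set. -/
theorem LinearIndependent.exists_orthonormalBasis_span {V : Type*} [NormedAddCommGroup V]
    [InnerProductSpace ℝ V] {n : ℕ} {u : Fin n → V} (hu : LinearIndependent ℝ u) :
    Nonempty (OrthonormalBasis (Fin n) ℝ (Submodule.span ℝ (Set.range u))) := by
  have : FiniteDimensional ℝ (Submodule.span ℝ (Set.range u)) :=
    FiniteDimensional.span_of_finite ℝ (Set.finite_range u)
  have h := finrank_span_eq_card hu
  rw [Fintype.card_fin] at h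
  exact ⟨(stdOrthonormalBasis ℝ _).reindex (finCongr h)⟩

/-- Hadamard's inequality for Gram determinants. -/
theorem Matrix.det_gram_le_prod_norm_sq {V : Type*} [NormedAddCommGroup V]
    [InnerProductSpace ℝ V] {n : ℕ} (v : Fin n → V) :
    (Matrix.gram ℝ v).det ≤ ∏ i, ‖v i‖ ^ 2 := by
  by_cases hv : LinearIndependent ℝ v
  · obtain ⟨b⟩ := hv.exists_orthonormalBasis_span
    let w : Fin n → Submodule.span ℝ (Set.range v) :=
      fun i => ⟨v i, Submodule.subset_span ⟨i, rfl⟩⟩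
    have hg : Matrix.gram ℝ v = Matrix.gram ℝ w := by
      ext i j
      simp [w]
    rw [hg, b.det_gram_eq_sq, Finset.prod_pow, ← sq_abs]
    exact pow_le_pow_left₀ (abs_nonneg _) (b.abs_det_le_prod_norm w) 2
  · have h0 : (Matrix.gram ℝ v).det = 0 := by
      by_contra h
      exact hv (Matrix.det_gram_ne_zero_iff_linearIndependent.1 h)
    rw [h0]
    positivity

/-- Cramer's rule combined with Hadamard's inequality bounds the coefficients of a vector with
respect to a linearly independent family. -/
theorem LinearIndependent.abs_coeff_mul_sqrt_det_gram_le {V : Type*} [NormedAddCommGroup V]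
    [InnerProductSpace ℝ V] {n : ℕ} {u : Fin n → V} (hu : LinearIndependent ℝ u)
    (c : Fin n → ℝ) (j : Fin n) :
    |c j| * √(Matrix.gram ℝ u).det ≤ ‖∑ i, c i • u i‖ * ∏ i ∈ Finset.univ.erase j, ‖u i‖ := by
  obtain ⟨b⟩ := hu.exists_orthonormalBasis_span
  let w : Fin n → Submodule.span ℝ (Set.range u) :=
    fun i => ⟨u i, Submodule.subset_span ⟨i, rfl⟩⟩
  have hg : Matrix.gram ℝ u = Matrix.gram ℝ w := by
    ext i j
    simp [w]
  have hdet : b.toBasis.det (Function.update w j (∑ i, c i • w i)) = c j * b.toBasis.det w := by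
    rw [AlternatingMap.map_update_sum, Finset.sum_eq_single j]
    · rw [AlternatingMap.map_update_smul, Function.update_eq_self, smul_eq_mul]
    · intro i _ hij
      rw [AlternatingMap.map_update_smul, AlternatingMap.map_update_self _ _ hij.symm, smul_zero]
    · simp
  have hle := b.abs_det_le_prod_norm (Function.update w j (∑ i, c i • w i))
  rw [hdet, abs_mul, ← Finset.mul_prod_erase _ _ (Finset.mem_univ j)] at hle
  rw [hg, b.det_gram_eq_sq, Real.sqrt_sq_eq_abs]
  refine hle.trans (le_of_eq ?_)
  congr 1
  · rw [Function.update_self, ← Submodule.norm_coe]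
    simp [w, -SetLike.mk_smul_mk]
  · refine Finset.prod_congr rfl fun i hi => ?_
    rw [Function.update_of_ne (Finset.ne_of_mem_erase hi)]
    rfl

/-- A linear map of norm at most `K` increases Gram determinants of `n` vectors by a factor of
at most `K ^ (2 * n)`. -/
theorem LinearIndependent.det_gram_map_le {V V' : Type*} [NormedAddCommGroup V]
    [InnerProductSpace ℝ V] [NormedAddCommGroup V'] [InnerProductSpace ℝ V'] {n : ℕ}
    {u : Fin n → V} (hu : LinearIndependent ℝ u) (L : V →ₗ[ℝ] V') {K : ℝ}
    (hL : ∀ x, ‖L x‖ ≤ K * ‖x‖) :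
    (Matrix.gram ℝ (fun i => L (u i))).det ≤ (K ^ n) ^ 2 * (Matrix.gram ℝ u).det := by
  obtain ⟨b⟩ := hu.exists_orthonormalBasis_span
  let w : Fin n → Submodule.span ℝ (Set.range u) :=
    fun i => ⟨u i, Submodule.subset_span ⟨i, rfl⟩⟩
  have hg : Matrix.gram ℝ u = Matrix.gram ℝ w := by
    ext i j
    simp [w]
  let A := b.toBasis.toMatrix w
  have hexp : ∀ i, u i = ∑ l, A l i • (b l : V) := by
    intro i
    have h := congrArg Subtype.val (b.toBasis.sum_toMatrix_smul_self w i)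
    simpa [w, A] using h.symm
  have hgL : Matrix.gram ℝ (fun i => L (u i)) =
      A.transpose * Matrix.gram ℝ (fun i => L (b i : V)) * A := by
    ext i j
    rw [Matrix.gram_apply, hexp i, hexp j]
    simp only [map_sum, map_smul, inner_sum, sum_inner, inner_smul_left, inner_smul_right,
      Matrix.mul_apply, Matrix.gram_apply, Matrix.transpose_apply, Finset.sum_mul,
      Finset.mul_sum, conj_trivial]
    refine Finset.sum_congr rfl fun l _ => Finset.sum_congr rfl fun l' _ => ?_
    ring
  have hb : (Matrix.gram ℝ (fun i => L (b i : V))).det ≤ (K ^ n) ^ 2 := by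
    refine (Matrix.det_gram_le_prod_norm_sq _).trans ?_
    calc ∏ i, ‖L (b i : V)‖ ^ 2 ≤ ∏ _i : Fin n, K ^ 2 := by
          refine Finset.prod_le_prod (fun i _ => by positivity) fun i _ => ?_
          have h1 : ‖(b i : V)‖ = 1 := b.orthonormal.1 i
          have h := hL (b i : V)
          rw [h1, mul_one] at h
          exact pow_le_pow_left₀ (norm_nonneg _) h 2
      _ = (K ^ n) ^ 2 := by simp [pow_right_comm]
  rw [hgL, hg, b.det_gram_eq_sq, Matrix.det_mul, Matrix.det_mul, Matrix.det_transpose,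
    Module.Basis.det_apply]
  nlinarith [sq_nonneg A.det]

namespace PDForm

variable {d : ℕ}

/-- The space `ℝ^d`, equipped with the inner product given by a positive definite form. -/
def Space (_g : PDForm d) : Type := Fin d → ℝ

variable (g : PDForm d)

noncomputable instance : AddCommGroup g.Space := inferInstanceAs (AddCommGroup (Fin d → ℝ))

noncomputable instance : Module ℝ g.Space := inferInstanceAs (Module ℝ (Fin d → ℝ))

instance : FiniteDimensional ℝ g.Space :=
  inferInstanceAs (FiniteDimensional ℝ (Fin d → ℝ))

/-- The inner product structure given by a positive definite form. -/
noncomputable abbrev spaceCore : InnerProductSpace.Core ℝ g.Space where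
  inner x y := g.B x y
  conj_inner_symm x y := g.symm y x
  re_inner_nonneg x := by
    rcases eq_or_ne x 0 with rfl | hx
    · exact (congrArg (fun f => f 0) (map_zero g.B)).ge
    · exact (g.posdef x hx).le
  add_left x y z := by
    exact congrArg (fun f => f z) (map_add g.B x y)
  smul_left x y r := by
    exact congrArg (fun f => f y) (map_smul g.B r x)
  definite x hx := by
    by_contra h
    exact (g.posdef x h).ne' hx

noncomputable instance : NormedAddCommGroup g.Space :=
  g.spaceCore.toNormedAddCommGroup

noncomputable instance : InnerProductSpace ℝ g.Space :=
  InnerProductSpace.ofCore g.spaceCore.toCore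

/-- The identity map from `ℝ^d` to `g.Space`. -/
def toSpace : (Fin d → ℝ) ≃ₗ[ℝ] g.Space := LinearEquiv.refl ℝ _

theorem inner_toSpace (x y : Fin d → ℝ) : inner ℝ (g.toSpace x) (g.toSpace y) = g.inn x y :=
  rfl

theorem norm_toSpace (x : Fin d → ℝ) : ‖g.toSpace x‖ = g.nrm x := by
  rw [nrm, ← inner_toSpace, norm_eq_sqrt_real_inner]

theorem jap_eq (x : Fin d → ℝ) : g.jap x = √(1 + ‖g.toSpace x‖ ^ 2) := by
  rw [jap, ← inner_toSpace, real_inner_self_eq_norm_sq]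

theorem one_le_jap (x : Fin d → ℝ) : 1 ≤ g.jap x := by
  rw [jap_eq, Real.one_le_sqrt]
  nlinarith [sq_nonneg ‖g.toSpace x‖]

theorem nrm_nonneg (x : Fin d → ℝ) : 0 ≤ g.nrm x := Real.sqrt_nonneg _

theorem jap_add_le (x y : Fin d → ℝ) : g.jap (x + y) ≤ g.jap x + g.nrm y := by
  rw [jap_eq, jap_eq, ← norm_toSpace, map_add]
  set X := g.toSpace x
  set Y := g.toSpace y
  have h := norm_add_le X Y
  have hX : ‖X‖ ≤ √(1 + ‖X‖ ^ 2) := Real.le_sqrt_of_sq_le (by linarith)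
  have hsq : √(1 + ‖X‖ ^ 2) ^ 2 = 1 + ‖X‖ ^ 2 := Real.sq_sqrt (by positivity)
  refine Real.sqrt_le_iff.2 ⟨by positivity, ?_⟩
  nlinarith [norm_nonneg X, norm_nonneg Y, norm_nonneg (X + Y)]

theorem abs_inn_le (x y : Fin d → ℝ) : |g.inn x y| ≤ g.nrm x * g.nrm y := by
  rw [← inner_toSpace, ← norm_toSpace, ← norm_toSpace]
  exact abs_real_inner_le_norm _ _

theorem nrm_neg (x : Fin d → ℝ) : g.nrm (-x) = g.nrm x := by
  rw [← norm_toSpace, ← norm_toSpace, map_neg, norm_neg]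

theorem nrm_smul (r : ℝ) (x : Fin d → ℝ) : g.nrm (r • x) = |r| * g.nrm x := by
  rw [← norm_toSpace, ← norm_toSpace, map_smul, norm_smul, Real.norm_eq_abs]

theorem gvol_eq {s : ℕ} (u : Fin s → (Fin d → ℝ)) :
    gvol g u = √(Matrix.gram ℝ (fun i => g.toSpace (u i))).det := rfl

/-- The Euclidean norm is bounded by a multiple of the norm of a positive definite form. -/
theorem exists_euclidean_norm_le :
    ∃ K : ℝ, 1 ≤ K ∧ ∀ x : g.Space,
      ‖((WithLp.linearEquiv 2 ℝ (Fin d → ℝ)).symm.toLinearMap ∘ₗ g.toSpace.symm.toLinearMap) x‖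
        ≤ K * ‖x‖ := by
  let L := (WithLp.linearEquiv 2 ℝ (Fin d → ℝ)).symm.toLinearMap ∘ₗ g.toSpace.symm.toLinearMap
  refine ⟨max 1 ‖LinearMap.toContinuousLinearMap L‖, le_max_left _ _, fun x => ?_⟩
  refine ((LinearMap.toContinuousLinearMap L).le_opNorm x).trans ?_
  gcongr
  exact le_max_right _ _

end PDForm

/-- Gram determinants of linearly independent integer vectors for the Euclidean inner product
are at least one. -/
theorem one_le_det_gram_int {d s : ℕ} {u : Fin s → (Fin d → ℤ)}
    (hu : LinearIndependent ℝ (fun j => zc (u j))) :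
    1 ≤ (Matrix.gram ℝ (fun j => (WithLp.toLp 2 (zc (u j)) : EuclideanSpace ℝ (Fin d)))).det := by
  set v : Fin s → EuclideanSpace ℝ (Fin d) := fun j => WithLp.toLp 2 (zc (u j))
  have hv : LinearIndependent ℝ v :=
    hu.map' (WithLp.linearEquiv 2 ℝ (Fin d → ℝ)).symm.toLinearMap (LinearEquiv.ker _)
  have hpos : 0 < (Matrix.gram ℝ v).det :=
    (Matrix.posDef_gram_of_linearIndependent hv).det_pos
  have hint : Matrix.gram ℝ v =
      (Matrix.of fun i j => ∑ l, u j l * u i l : Matrix (Fin s) (Fin s) ℤ).map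
        (Int.castRingHom ℝ) := by
    ext i j
    simp [v, zc, Matrix.gram_apply, PiLp.inner_apply]
  rw [hint, ← RingHom.mapMatrix_apply, ← RingHom.map_det] at hpos ⊢
  simp only [eq_intCast] at hpos ⊢
  exact_mod_cast hpos

theorem one_le_euclidean_norm_zc {d : ℕ} {k : Fin d → ℤ} (hk : k ≠ 0) :
    1 ≤ ‖(WithLp.toLp 2 (zc k) : EuclideanSpace ℝ (Fin d))‖ := by
  obtain ⟨i, hi⟩ := Function.ne_iff.1 hk
  refine le_trans ?_ (PiLp.norm_apply_le (WithLp.toLp 2 (zc k) : EuclideanSpace ℝ (Fin d)) i)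
  simp only [zc, Real.norm_eq_abs]
  exact_mod_cast Int.one_le_abs hi

theorem frakc_pos {d : ℕ} (hd : 1 ≤ d) (g : PDForm d) : 0 < frakc g := by
  obtain ⟨K, hK, hL⟩ := g.exists_euclidean_norm_le
  refine lt_of_lt_of_le (b := (K⁻¹) ^ 2) (by positivity) (le_csInf ?_ ?_)
  · exact ⟨_, Pi.single ⟨0, hd⟩ 1, by simp, rfl⟩
  · rintro _ ⟨k, hk, rfl⟩
    have h := (one_le_euclidean_norm_zc hk).trans (hL (g.toSpace (zc k)))
    rw [g.norm_toSpace] at h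
    refine pow_le_pow_left₀ (by positivity) ?_ 2
    rwa [inv_le_iff_one_le_mul₀' (by positivity)]

theorem sqrt_frakc_le {d : ℕ} (g : PDForm d) {k : Fin d → ℤ} (hk : k ≠ 0) :
    √(frakc g) ≤ g.nrm (zc k) := by
  refine Real.sqrt_le_iff.2 ⟨g.nrm_nonneg _, csInf_le ⟨0, ?_⟩ ⟨k, hk, rfl⟩⟩
  rintro _ ⟨k, -, rfl⟩
  positivity

theorem frakC_pos {d : ℕ} (hd : 1 ≤ d) (g : PDForm d) : 0 < frakC g := by
  obtain ⟨K, hK, hL⟩ := g.exists_euclidean_norm_le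
  refine lt_of_lt_of_le (b := (K ^ d)⁻¹) (by positivity) (le_csInf ?_ ?_)
  · refine ⟨_, 1, fun _ => Pi.single ⟨0, hd⟩ 1, le_rfl, hd, ?_, rfl⟩
    rw [linearIndependent_unique_iff]
    intro h
    simpa [zc] using congrFun h ⟨0, hd⟩
  · rintro _ ⟨s, u, -, hsd, hu, rfl⟩
    have hu' : LinearIndependent ℝ (fun j => g.toSpace (zc (u j))) :=
      hu.map' g.toSpace.toLinearMap (LinearEquiv.ker _)
    have h := (one_le_det_gram_int hu).trans (hu'.det_gram_map_le _ hL)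
    have hKsd : K ^ s ≤ K ^ d := pow_le_pow_right₀ hK hsd
    have hG : 0 < (Matrix.gram ℝ fun j => g.toSpace (zc (u j))).det :=
      (Matrix.posDef_gram_of_linearIndependent hu').det_pos
    rw [g.gvol_eq]
    refine Real.le_sqrt_of_sq_le ?_
    rw [inv_pow, inv_le_iff_one_le_mul₀' (by positivity)]
    refine h.trans ?_
    gcongr

theorem frakC_le_gvol {d s : ℕ} (g : PDForm d) {u : Fin s → (Fin d → ℤ)} (hs : 1 ≤ s)
    (hsd : s ≤ d) (hu : LinearIndependent ℝ (fun j => zc (u j))) :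
    frakC g ≤ gvol g (fun j => zc (u j)) := by
  refine csInf_le ⟨0, ?_⟩ ⟨s, u, hs, hsd, hu, rfl⟩
  rintro _ ⟨s, u, -, -, -, rfl⟩
  exact Real.sqrt_nonneg _

/-- The cast from `ℤ^d` to `ℝ^d` as a linear map. -/
def zcLinear (d : ℕ) : (Fin d → ℤ) →ₗ[ℤ] (Fin d → ℝ) where
  toFun := zc
  map_add' x y := by ext; simp [zc]
  map_smul' c x := by ext; simp [zc]

theorem zc_add {d : ℕ} (x y : Fin d → ℤ) : zc (x + y) = zc x + zc y :=
  (zcLinear d).map_add x y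

/-- A maximal linearly independent family of a lattice spans the lattice over the reals. -/
theorem zc_mem_span_of_linearIndependent {d s : ℕ} {M : Submodule ℤ (Fin d → ℤ)}
    (hM : zrank M = s) {k : Fin s → (Fin d → ℤ)} (hk : ∀ j, k j ∈ M)
    (hli : LinearIndependent ℝ (fun j => zc (k j))) {m : Fin d → ℤ} (hm : m ∈ M) :
    zc m ∈ Submodule.span ℝ (Set.range fun j => zc (k j)) := by
  let b := Module.finBasis ℤ M
  let S := Submodule.span ℝ (Set.range fun i => zc (b i : Fin d → ℤ))
  have hMS : ∀ x ∈ M, zc x ∈ S := by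
    intro x hx
    have h := congrArg (fun y : M => zcLinear d y) (b.sum_repr ⟨x, hx⟩)
    simp only [AddSubmonoidClass.coe_finsetSum, map_sum, Submodule.coe_smul, map_smul] at h
    change _ = zc x at h
    rw [← h]
    refine Submodule.sum_mem _ fun i _ => ?_
    rw [← Int.cast_smul_eq_zsmul ℝ]
    exact Submodule.smul_mem _ _ (Submodule.subset_span ⟨i, rfl⟩)
  have hle : Submodule.span ℝ (Set.range fun j => zc (k j)) ≤ S := by
    rw [Submodule.span_le]
    rintro _ ⟨j, rfl⟩
    exact hMS _ (hk j)
  have hfin : Module.finrank ℝ S ≤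
      Module.finrank ℝ (Submodule.span ℝ (Set.range fun j => zc (k j))) := by
    rw [finrank_span_eq_card hli, Fintype.card_fin, ← hM]
    refine (finrank_range_le_card _).trans ?_
    simp [zrank]
  rw [Submodule.eq_of_le_of_finrank_le hle hfin]
  exact hMS m hm

theorem xik_eq {d : ℕ} (κ : Fin d → ℝ) (ξ k : Fin d → ℤ) :
    xik κ ξ k = (zc ξ + κ) + (1 / 2 : ℝ) • zc k := by
  ext i
  simp only [xik, zc, Pi.add_apply, Pi.smul_apply, smul_eq_mul]
  ring

theorem le_of_forall_lt_succ {d s : ℕ} (hsd : s ≤ d - 1) {A : ℕ → ℝ}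
    (hA : ∀ j, j + 2 ≤ d → A j < A (j + 1)) {i j : ℕ} (hij : i ≤ j) (hj : j < s) :
    A i ≤ A j := by
  induction j, hij using Nat.le_induction with
  | base => exact le_rfl
  | succ n _ ih => exact (ih (by omega)).trans (hA n (by omega)).le

/-- If `‖k‖` is at most a power of `⟨ξ_k⟩` with exponent at most one, then `⟨ξ_k⟩` is comparable
to `⟨ξ+κ⟩`. -/
theorem PDForm.jap_xik_le {d : ℕ} (g : PDForm d) {κ : Fin d → ℝ} {ξ k : Fin d → ℤ} {ε : ℝ}
    (hε : ε ≤ 1) (hk : g.nrm (zc k) ≤ g.jap (xik κ ξ k) ^ ε) :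
    g.jap (xik κ ξ k) ≤ 2 * g.jap (zc ξ + κ) := by
  have h1 := g.one_le_jap (xik κ ξ k)
  have h2 : g.jap (xik κ ξ k) ^ ε ≤ g.jap (xik κ ξ k) := Real.rpow_le_self_of_one_le h1 hε
  have h3 := g.jap_add_le (zc ξ + κ) ((1 / 2 : ℝ) • zc k)
  rw [← xik_eq, g.nrm_smul, abs_of_pos (by norm_num)] at h3
  linarith

/-- A vector having small inner products with a family of short, linearly independent integer
vectors has a small projection on the span of the family. -/
theorem PDForm.abs_inn_le_of_mem_span {d s : ℕ} (g : PDForm d) (hs : 1 ≤ s) (hsd : s ≤ d)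
    {k : Fin s → (Fin d → ℤ)} (hk : LinearIndependent ℝ (fun j => zc (k j)))
    {x y : Fin d → ℝ} {α N : ℝ} (hx : ∀ j, |g.inn x (zc (k j))| ≤ α)
    (hN : ∀ j, g.nrm (zc (k j)) ≤ N)
    (hy : y ∈ Submodule.span ℝ (Set.range fun j => zc (k j))) :
    |g.inn x y| ≤ s * α * N ^ (s - 1) / frakC g * g.nrm y := by
  obtain ⟨c, rfl⟩ := (Submodule.mem_span_range_iff_exists_fun ℝ).1 hy
  have hF := frakC_pos (hs.trans hsd) g
  have hα : 0 ≤ α := (abs_nonneg _).trans (hx ⟨0, hs⟩)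
  set y := ∑ i, c i • zc (k i) with hy_def
  have hc : ∀ j, |c j| ≤ N ^ (s - 1) / frakC g * g.nrm y := by
    intro j
    have hk' : LinearIndependent ℝ (fun j => g.toSpace (zc (k j))) :=
      hk.map' g.toSpace.toLinearMap (LinearEquiv.ker _)
    have h := hk'.abs_coeff_mul_sqrt_det_gram_le c j
    rw [← g.gvol_eq (fun j => zc (k j))] at h
    have hsum : ∑ i, c i • g.toSpace (zc (k i)) = g.toSpace y := by simp [hy_def]
    simp only [hsum, g.norm_toSpace] at h
    have hprod : ∏ i ∈ Finset.univ.erase j, g.nrm (zc (k i)) ≤ N ^ (s - 1) := by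
      calc ∏ i ∈ Finset.univ.erase j, g.nrm (zc (k i))
          ≤ ∏ _i ∈ Finset.univ.erase j, N :=
            Finset.prod_le_prod (fun i _ => g.nrm_nonneg _) fun i _ => hN i
        _ = N ^ (s - 1) := by simp
    rw [div_mul_eq_mul_div, le_div_iff₀ hF]
    calc |c j| * frakC g ≤ |c j| * gvol g (fun j => zc (k j)) := by
          gcongr
          exact frakC_le_gvol g hs hsd hk
      _ ≤ _ := h
      _ ≤ g.nrm y * N ^ (s - 1) := by
          gcongr
          exact g.nrm_nonneg _
      _ = _ := mul_comm _ _
  calc |g.inn x y| = |∑ i, c i * g.inn x (zc (k i))| := by simp [hy_def, PDForm.inn]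
    _ ≤ ∑ i, |c i * g.inn x (zc (k i))| := Finset.abs_sum_le_sum_abs _ _
    _ ≤ ∑ _i : Fin s, N ^ (s - 1) / frakC g * g.nrm y * α := by
        refine Finset.sum_le_sum fun i _ => ?_
        rw [abs_mul]
        exact mul_le_mul (hc i) (hx i) (abs_nonneg _) ((abs_nonneg _).trans (hc i))
    _ = _ := by
        rw [Finset.sum_const, Finset.card_univ, Fintype.card_fin, nsmul_eq_mul]
        ring

/-- The constant bounding the projection of a resonant point on its resonance module. -/
noncomputable def projConst (s : ℕ) (τ p a b c e : ℝ) : ℝ :=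
  (|s * (c * √a ^ (-τ)) * e ^ (s - 1) / b| + 1 / 2) * 2 ^ p

theorem projConst_pos (s : ℕ) (τ p a b c e : ℝ) : 0 < projConst s τ p a b c e := by
  unfold projConst
  positivity

/-- The projection of a point of the zone `Z⁽ˢ⁾_M` on `M` is small. -/
theorem abs_inn_le_of_mem_ZM {d s : ℕ} {δ ε τ p : ℝ} (hpar : ParamsOK d δ ε τ) (hs1 : 1 ≤ s)
    (hsd : s ≤ d - 1) (hp : p = δ + ((s : ℝ) - 1) * ((d + τ + 1) * ε) + ε * d) (hp1 : p < 1)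
    (g : PDForm d) (κ : Fin d → ℝ) (E : Set (Fin d → ℤ)) {Cs Ds : ℕ → ℝ}
    (hseq : SeqOK d Cs Ds) {M : Submodule ℤ (Fin d → ℤ)} (hM : zrank M = s)
    {ξ m : Fin d → ℤ} (hξ : ξ ∈ (⟨g, κ, E, δ, ε, τ, Cs, Ds⟩ : ZoneData d).ZM s M) (hm : m ∈ M) :
    |g.inn (zc ξ + κ) (zc m)| ≤
      projConst s τ p (frakc g) (frakC g) (Cs (s - 1)) (Ds (s - 1)) * g.jap (zc ξ + κ) ^ p *
        g.nrm (zc m) := by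
  obtain ⟨-, hs, k, hkM, hli, hk⟩ := hξ
  obtain ⟨hd, hδ, -, hε, hτ, -, -⟩ := hpar
  obtain ⟨hC0, hD0, hC, hD⟩ := hseq
  have hd1 : (1 : ℝ) ≤ d := by exact_mod_cast hd
  have hs1' : (1 : ℝ) ≤ s := by exact_mod_cast hs1
  have hsd' : (s : ℝ) ≤ d := by exact_mod_cast hsd.trans (Nat.sub_le _ _)
  have hτ0 : 0 < τ := by linarith
  simp only [ZoneData.δs] at hk
  set J := g.jap (xik κ ξ (k ⟨0, hs⟩))
  have hJ : 1 ≤ J := g.one_le_jap _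
  have hJ0 : 0 < J := by linarith
  have hq : 0 ≤ (d + τ + 1) * ε := by positivity
  have hεd : ε ≤ ε * d := by nlinarith
  have hεp : ε ≤ p := by nlinarith
  have hC1 : 1 ≤ Cs (s - 1) := by
    rw [← hC0]
    exact le_of_forall_lt_succ hsd hC (Nat.zero_le _) (by omega)
  have hD1 : 1 ≤ Ds (s - 1) := by
    rw [← hD0]
    exact le_of_forall_lt_succ hsd hD (Nat.zero_le _) (by omega)
  have hc0 : 0 < √(frakc g) := Real.sqrt_pos.2 (frakc_pos hd g)
  have hF0 := frakC_pos hd g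
  set δ' := δ + ((s : ℝ) - 1) * ((d + τ + 1) * ε) with hδ'
  have hα : ∀ j, |g.inn (xik κ ξ (k ⟨0, hs⟩)) (zc (k j))| ≤
      Cs (s - 1) * √(frakc g) ^ (-τ) * J ^ δ' := by
    intro j
    have hkj : k j ≠ 0 := by
      intro h
      refine hli.ne_zero j ?_
      simp only [h]
      ext
      simp [zc]
    have hj1 : (j : ℝ) ≤ (s : ℝ) - 1 := by
      rw [le_sub_iff_add_le]
      exact_mod_cast j.2
    have h1 : Cs j ≤ Cs (s - 1) := le_of_forall_lt_succ hsd hC (by omega) (by omega)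
    have h2 : J ^ (δ + j * ((d + τ + 1) * ε)) ≤ J ^ δ' :=
      Real.rpow_le_rpow_of_exponent_le hJ (by rw [hδ']; gcongr)
    have h3 : g.nrm (zc (k j)) ^ (-τ) ≤ √(frakc g) ^ (-τ) :=
      Real.rpow_le_rpow_of_nonpos hc0 (sqrt_frakc_le g hkj) (by linarith)
    have hn : 0 ≤ g.nrm (zc (k j)) ^ (-τ) := Real.rpow_nonneg (g.nrm_nonneg _) _
    calc _ ≤ _ := (hk j).1
      _ ≤ Cs (s - 1) * J ^ δ' * √(frakc g) ^ (-τ) := by gcongr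
      _ = _ := by ring
  have hN : ∀ j, g.nrm (zc (k j)) ≤ Ds (s - 1) * J ^ ε := by
    intro j
    refine (hk j).2.trans ?_
    gcongr
    exact le_of_forall_lt_succ hsd hD (by omega) (by omega)
  have hk0 : g.nrm (zc (k ⟨0, hs⟩)) ≤ J ^ ε := by
    have h := (hk ⟨0, hs⟩).2
    simpa only [hD0, one_mul] using h
  have hmain := g.abs_inn_le_of_mem_span hs1 (hsd.trans (Nat.sub_le _ _)) hli hα hN
    (zc_mem_span_of_linearIndependent hM hkM hli hm)
  have hpow : J ^ δ' * (J ^ ε) ^ (s - 1) ≤ J ^ p := by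
    rw [← Real.rpow_natCast, ← Real.rpow_mul hJ0.le, ← Real.rpow_add hJ0]
    refine Real.rpow_le_rpow_of_exponent_le hJ ?_
    rw [hp, Nat.cast_sub hs1, Nat.cast_one]
    gcongr
    linarith
  have hmain' : |g.inn (xik κ ξ (k ⟨0, hs⟩)) (zc m)| ≤
      |s * (Cs (s - 1) * √(frakc g) ^ (-τ)) * Ds (s - 1) ^ (s - 1) / frakC g| * J ^ p *
        g.nrm (zc m) := by
    refine hmain.trans ?_
    have hm0 := g.nrm_nonneg (zc m)
    refine mul_le_mul_of_nonneg_right ?_ hm0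
    refine le_trans (le_of_eq ?_) (mul_le_mul (le_abs_self _) hpow (by positivity) (abs_nonneg _))
    rw [mul_pow]
    ring
  have hhalf : |g.inn ((1 / 2 : ℝ) • zc (k ⟨0, hs⟩)) (zc m)| ≤ 1 / 2 * J ^ p * g.nrm (zc m) := by
    refine (g.abs_inn_le _ _).trans (mul_le_mul_of_nonneg_right ?_ (g.nrm_nonneg _))
    rw [g.nrm_smul, abs_of_pos (by norm_num)]
    gcongr
    exact hk0.trans (Real.rpow_le_rpow_of_exponent_le hJ hεp)
  have hsplit : g.inn (zc ξ + κ) (zc m) = g.inn (xik κ ξ (k ⟨0, hs⟩)) (zc m) -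
      g.inn ((1 / 2 : ℝ) • zc (k ⟨0, hs⟩)) (zc m) := by
    simp only [xik_eq, PDForm.inn, map_add, LinearMap.add_apply]
    ring
  have hJp : J ^ p ≤ 2 ^ p * g.jap (zc ξ + κ) ^ p := by
    have hj := g.one_le_jap (zc ξ + κ)
    rw [← Real.mul_rpow (by norm_num) (by linarith)]
    exact Real.rpow_le_rpow hJ0.le (g.jap_xik_le (by linarith) hk0) (by linarith)
  calc |g.inn (zc ξ + κ) (zc m)| ≤
        |g.inn (xik κ ξ (k ⟨0, hs⟩)) (zc m)| +
          |g.inn ((1 / 2 : ℝ) • zc (k ⟨0, hs⟩)) (zc m)| := by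
        rw [hsplit]
        exact abs_sub _ _
    _ ≤ (|s * (Cs (s - 1) * √(frakc g) ^ (-τ)) * Ds (s - 1) ^ (s - 1) / frakC g| + 1 / 2) *
          J ^ p * g.nrm (zc m) := by linarith
    _ ≤ (|s * (Cs (s - 1) * √(frakc g) ^ (-τ)) * Ds (s - 1) ^ (s - 1) / frakC g| + 1 / 2) *
          (2 ^ p * g.jap (zc ξ + κ) ^ p) * g.nrm (zc m) := by
        have hm0 := g.nrm_nonneg (zc m)
        gcongr
    _ = _ := by
        rw [projConst]
        ring

/-- Two quantities whose distance is bounded by sublinear powers are comparable. -/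
theorem le_mul_of_le_add_rpow {K p a b : ℝ} (hp0 : 0 < p) (hp1 : p < 1)
    (ha : 1 ≤ a) (hb : 1 ≤ b) (hK : 0 < K) (h : b ≤ a + K * (a ^ p + b ^ p)) :
    b ≤ max 2 ((4 * K) ^ (1 - p)⁻¹) * a := by
  by_cases hab : b ≤ 2 * a
  · exact hab.trans (by gcongr; exact le_max_left _ _)
  · push Not at hab
    have hb0 : 0 < b := by linarith
    have h1 : a ^ p ≤ b ^ p := Real.rpow_le_rpow (by linarith) (by linarith) hp0.le
    have h2 : b ≤ 4 * K * b ^ p := by nlinarith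
    have h3 : b ^ (1 - p) ≤ 4 * K := by
      rw [Real.rpow_sub hb0, Real.rpow_one, div_le_iff₀ (by positivity)]
      exact h2
    have h4 : b ≤ (4 * K) ^ (1 - p)⁻¹ := by
      have h := Real.rpow_le_rpow (by positivity) h3 (inv_nonneg.2 (by linarith : 0 ≤ 1 - p))
      rwa [Real.rpow_rpow_inv hb0.le (by linarith)] at h
    calc b ≤ max 2 ((4 * K) ^ (1 - p)⁻¹) * 1 := by
          rw [mul_one]
          exact h4.trans (le_max_right _ _)
      _ ≤ _ := by gcongr

theorem le_mul_rpow_of_le_add_rpow {K p a b n : ℝ} (hp0 : 0 < p) (hp1 : p < 1)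
    (ha : 1 ≤ a) (hb : 1 ≤ b) (hK : 0 < K) (hba : b ≤ a + n)
    (hn : n ≤ K * (a ^ p + b ^ p)) :
    n ≤ K * (1 + max 2 ((4 * K) ^ (1 - p)⁻¹) ^ p) * a ^ p := by
  have h := le_mul_of_le_add_rpow hp0 hp1 ha hb hK (by linarith)
  have h1 : b ^ p ≤ max 2 ((4 * K) ^ (1 - p)⁻¹) ^ p * a ^ p := by
    rw [← Real.mul_rpow (by positivity) (by linarith)]
    exact Real.rpow_le_rpow (by linarith) h hp0.le
  refine hn.trans ?_
  rw [mul_assoc]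
  gcongr
  linarith

/-- diameter estimate for the extended blocks. Let `1 ≤ s ≤ d-1` and
assume `δ_{s-1} + dε < 1`. There is `F > 0`, depending only on
`𝔠, 𝔉, d, ε, τ, δ_{s-1}, C_{s-1}, D_{s-1}`, such that for every submodule `M` of dimension
`s` and every `ζ ∈ E⁽ˢ⁾_M` there is `ξ ∈ B⁽ˢ⁾_M` with `ζ - ξ ∈ M`,
`‖ξ-ζ‖ ≤ F ⟨ξ+κ⟩^{δ_{s-1}+εd}` and `‖ξ-ζ‖ ≤ F ⟨ζ+κ⟩^{δ_{s-1}+εd}`. -/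
theorem statement8 (d s : ℕ) (δ ε τ : ℝ) (hpar : ParamsOK d δ ε τ)
    (hs1 : 1 ≤ s) (hsd : s ≤ d - 1)
    (hexp : δ + ((s : ℝ) - 1) * ((d + τ + 1) * ε) + d * ε < 1) :
    ∃ F : ℝ → ℝ → ℝ → ℝ → ℝ,
      (∀ a b c e, 0 < F a b c e) ∧
      ∀ (g : PDForm d) (κ : Fin d → ℝ) (E : Set (Fin d → ℤ)) (Cs Ds : ℕ → ℝ),
        SeqOK d Cs Ds →
        let Z : ZoneData d := ⟨g, κ, E, δ, ε, τ, Cs, Ds⟩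
        ∀ (M : Submodule ℤ (Fin d → ℤ)), IsSat M → zrank M = s →
          ∀ ζ ∈ Z.EM s M, ∃ ξ ∈ Z.BM s M,
            ζ - ξ ∈ M ∧
            g.nrm (zc ξ - zc ζ) ≤ F (frakc g) (frakC g) (Cs (s - 1)) (Ds (s - 1)) *
              (g.jap (zc ξ + κ)) ^ (δ + ((s : ℝ) - 1) * ((d + τ + 1) * ε) + ε * d) ∧
            g.nrm (zc ξ - zc ζ) ≤ F (frakc g) (frakC g) (Cs (s - 1)) (Ds (s - 1)) *
              (g.jap (zc ζ + κ)) ^ (δ + ((s : ℝ) - 1) * ((d + τ + 1) * ε) + ε * d) := by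
  set p := δ + ((s : ℝ) - 1) * ((d + τ + 1) * ε) + ε * d with hp
  have hp1 : p < 1 := by
    rw [hp]
    linarith
  have hp0 : 0 < p := by
    obtain ⟨hd, hδ, -, hε, hτ, -, -⟩ := hpar
    have hd1 : (1 : ℝ) ≤ d := by exact_mod_cast hd
    have hs1' : (0 : ℝ) ≤ (s : ℝ) - 1 := sub_nonneg.2 (by exact_mod_cast hs1)
    have hτ0 : 0 < τ := by linarith
    positivity
  refine ⟨fun a b c e => projConst s τ p a b c e *
    (1 + max 2 ((4 * projConst s τ p a b c e) ^ (1 - p)⁻¹) ^ p), fun a b c e => ?_, ?_⟩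
  · have := projConst_pos s τ p a b c e
    positivity
  intro g κ E Cs Ds hseq Z M _ hM ζ hζ
  rw [ZoneData.EM] at hζ
  obtain ⟨⟨ξ, hξ, m, hm, rfl⟩, hζZ, -⟩ := hζ
  have hK := projConst_pos s τ p (frakc g) (frakC g) (Cs (s - 1)) (Ds (s - 1))
  set K := projConst s τ p (frakc g) (frakC g) (Cs (s - 1)) (Ds (s - 1))
  have h1 := abs_inn_le_of_mem_ZM hpar hs1 hsd hp hp1 g κ E hseq hM hξ.1 hm
  have h2 := abs_inn_le_of_mem_ZM hpar hs1 hsd hp hp1 g κ E hseq hM hζZ hm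
  have hshift : zc (ξ + m) + κ = zc ξ + κ + zc m := by
    rw [zc_add]
    abel
  have hdiff : zc ξ - zc (ξ + m) = -zc m := by
    rw [zc_add]
    abel
  have hsq : g.nrm (zc m) ^ 2 =
      g.inn (zc (ξ + m) + κ) (zc m) - g.inn (zc ξ + κ) (zc m) := by
    rw [hshift, ← g.norm_toSpace, ← real_inner_self_eq_norm_sq, g.inner_toSpace]
    simp [PDForm.inn]
  have hn0 := g.nrm_nonneg (zc m)
  have ha := g.one_le_jap (zc ξ + κ)
  have hb := g.one_le_jap (zc (ξ + m) + κ)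
  have hn : g.nrm (zc m) ≤ K * (g.jap (zc ξ + κ) ^ p + g.jap (zc (ξ + m) + κ) ^ p) := by
    rcases hn0.eq_or_lt with h0 | h0
    · rw [← h0]
      positivity
    · refine le_of_mul_le_mul_right ?_ h0
      have := (abs_le.1 h1).1
      have := (abs_le.1 h2).2
      linarith
  have hba : g.jap (zc (ξ + m) + κ) ≤ g.jap (zc ξ + κ) + g.nrm (zc m) := by
    rw [hshift]
    exact g.jap_add_le _ _
  have hab : g.jap (zc ξ + κ) ≤ g.jap (zc (ξ + m) + κ) + g.nrm (zc m) := by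
    rw [← g.nrm_neg (zc m)]
    refine le_trans (le_of_eq ?_) (g.jap_add_le _ _)
    rw [hshift, add_neg_cancel_right]
  refine ⟨ξ, hξ, by simpa using hm, ?_, ?_⟩
  · rw [hdiff, g.nrm_neg]
    exact le_mul_rpow_of_le_add_rpow hp0 hp1 ha hb hK hba hn
  · rw [hdiff, g.nrm_neg]
    exact le_mul_rpow_of_le_add_rpow hp0 hp1 hb ha hK hab (by rwa [add_comm])
end

section
/- (Negative-norm decay under a Gauge shift, Fourier-side formulation.) Let M ⊆ ℝ^d be a linear subspace, let κ, β ∈ ℝ^d, write w := β + κ and let w_M, w_{M⊥} be the orthogonal projections of w onto M and onto its orthogonal complement, and set κ′ := w_M. Let N ∈ ℕ, let Λ ⊆ M be countable, let (û_ζ)_{ζ∈Λ} be complex numbers, and let K ≥ 0 be such that Σ_{ζ∈Λ} ⟨ζ+κ′⟩^{−2N} |û_ζ|² ≤ K². Then Σ_{ζ∈Λ} ⟨ζ+β+κ⟩^{−4N} |û_ζ|² ≤ K² / ⟨w_{M⊥}⟩^{2N}. The key pointwise inequality is ⟨ζ+β+κ⟩² ≥ ⟨ζ+κ′⟩ ·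 ⟨w_{M⊥}⟩ for every ζ ∈ M. -/
namespace PDForm

variable {d : ℕ} (g : PDForm d)

lemma inn_self_nonneg (x : Fin d → ℝ) : 0 ≤ g.inn x x := by
  rcases eq_or_ne x 0 with rfl | hx
  · simp [inn]
  · exact (g.posdef x hx).le

lemma jap_sq (x : Fin d → ℝ) : g.jap x ^ 2 = 1 + g.inn x x :=
  Real.sq_sqrt (by linarith [g.inn_self_nonneg x])

lemma jap_pos (x : Fin d → ℝ) : 0 < g.jap x :=
  Real.sqrt_pos.2 (by linarith [g.inn_self_nonneg x])

/-- The Pythagorean identity for the form. -/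
lemma inn_add_self_of_inn_eq_zero {x y : Fin d → ℝ} (h : g.inn y x = 0) :
    g.inn (x + y) (x + y) = g.inn x x + g.inn y y := by
  have h' : g.inn x y = 0 := (g.symm x y).trans h
  simp only [inn] at h h' ⊢
  simp [h, h']

lemma jap_mul_jap_le_of_inn_eq_zero {x y : Fin d → ℝ} (h : g.inn y x = 0) :
    g.jap x * g.jap y ≤ g.jap (x + y) ^ 2 := by
  rw [g.jap_sq, g.inn_add_self_of_inn_eq_zero h]
  nlinarith [g.jap_sq x, g.jap_sq y, g.inn_self_nonneg x, g.inn_self_nonneg y,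
    sq_nonneg (g.jap x - g.jap y)]

end PDForm

/-- negative-norm decay under a Gauge shift, Fourier side. With
`w = β + κ = w_M + w_{M⊥}` the orthogonal decomposition relative to the subspace `M`
and `κ' = w_M`, if `Σ_ζ ⟨ζ+κ'⟩^{-2N} |û_ζ|² ≤ K²` over a countable `Λ ⊆ M`, then
`Σ_ζ ⟨ζ+β+κ⟩^{-4N} |û_ζ|² ≤ K²/⟨w_{M⊥}⟩^{2N}`; the key pointwise inequality is
`⟨ζ+β+κ⟩² ≥ ⟨ζ+κ'⟩·⟨w_{M⊥}⟩` for `ζ ∈ M`. -/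
theorem statement12 {d : ℕ} (g : PDForm d) (M : Submodule ℝ (Fin d → ℝ))
    (κ β : Fin d → ℝ) (wM wP : Fin d → ℝ)
    (hwM : wM ∈ M) (hwP : ∀ v ∈ M, g.inn wP v = 0)
    (hsplit : β + κ = wM + wP)
    (N : ℕ) (Λ : Set (Fin d → ℝ)) (hΛM : Λ ⊆ (M : Set (Fin d → ℝ)))
    (hcount : Λ.Countable)
    (u : (Fin d → ℝ) → ℂ) (K : ℝ) (hK : 0 ≤ K)
    (hsum : Summable fun ζ : Λ => ‖u ζ‖ ^ 2 / (g.jap ((ζ : Fin d → ℝ) + wM)) ^ (2 * N))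
    (hbound : ∑' ζ : Λ, ‖u ζ‖ ^ 2 / (g.jap ((ζ : Fin d → ℝ) + wM)) ^ (2 * N) ≤ K ^ 2) :
    (∀ ζ ∈ M, (g.jap (ζ + β + κ)) ^ 2 ≥ g.jap (ζ + wM) * g.jap wP) ∧
    Summable (fun ζ : Λ => ‖u ζ‖ ^ 2 / (g.jap ((ζ : Fin d → ℝ) + β + κ)) ^ (4 * N)) ∧
    ∑' ζ : Λ, ‖u ζ‖ ^ 2 / (g.jap ((ζ : Fin d → ℝ) + β + κ)) ^ (4 * N) ≤
      K ^ 2 / (g.jap wP) ^ (2 * N) := by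
  have key : ∀ ζ ∈ M, g.jap (ζ + wM) * g.jap wP ≤ g.jap (ζ + β + κ) ^ 2 := by
    intro ζ hζ
    rw [add_assoc ζ, hsplit, ← add_assoc]
    exact g.jap_mul_jap_le_of_inn_eq_zero (hwP _ (M.add_mem hζ hwM))
  have hle : ∀ ζ : Λ, ‖u ζ‖ ^ 2 / g.jap ((ζ : Fin d → ℝ) + β + κ) ^ (4 * N) ≤
      ‖u ζ‖ ^ 2 / g.jap ((ζ : Fin d → ℝ) + wM) ^ (2 * N) / g.jap wP ^ (2 * N) := by
    intro ζ
    have hx := g.jap_pos ((ζ : Fin d → ℝ) + wM)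
    have hy := g.jap_pos wP
    rw [div_div, ← mul_pow, show 4 * N = 2 * (2 * N) by ring, pow_mul]
    gcongr
    exact key ζ (hΛM ζ.2)
  have hsum' := hsum.div_const (g.jap wP ^ (2 * N))
  have hs : Summable fun ζ : Λ => ‖u ζ‖ ^ 2 / g.jap ((ζ : Fin d → ℝ) + β + κ) ^ (4 * N) :=
    hsum'.of_nonneg_of_le (fun ζ => by have := g.jap_pos ((ζ : Fin d → ℝ) + β + κ); positivity) hle
  refine ⟨key, hs, (hs.tsum_le_tsum hle hsum').trans ?_⟩
  rw [tsum_div_const]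
  have := g.jap_pos wP
  gcongr
end
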